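/- Let H₁ and H₂ be graphs of odd girth, let k = g(H₁), and let p ∈ (0,1). If (H₁,H₂) is (p,1-p)-common, then g(H₂) = k and p = 1/(α+1), where α = (c_k(H₂)·e(H₁)/(c_k(H₁)·e(H₂)))^{1/(k-1)}. -/

import Mathlib

open MeasureTheory Finset

/-- The uniform measure on the unit interval `[0,1]`, as a measure on `ℝ`. -/
noncomputable def unitM : Measure ℝ := volume.restrict (Set.Icc 0 1)

instance : SigmaFinite unitM := by unfold unitM; infer_instance

/-- Value of a symmetric two-variable function on an unordered pair of vertices. -/
noncomputable def symEdge {α : Type*} (W : ℝ → ℝ → ℝ) (x : α → ℝ) : Sym2 α → ℝ :=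
  Sym2.lift ⟨fun u v => (W (x u) (x v) + W (x v) (x u)) / 2, fun u v => by ring⟩

open Classical in
/-- Homomorphism density of a finite simple graph in a kernel. -/
noncomputable def homDensity {V : Type*} [Fintype V] (G : SimpleGraph V)
    (W : ℝ → ℝ → ℝ) : ℝ :=
  ∫ x : V → ℝ, ∏ e ∈ G.edgeFinset, symEdge W x e ∂(Measure.pi fun _ => unitM)

/-- Number of edges of a graph. -/
noncomputable def eCount {V : Type*} (G : SimpleGraph V) : ℕ := G.edgeSet.ncard

def IsSymm2 (W : ℝ → ℝ → ℝ) : Prop := ∀ x y, W x y = W y x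

/-- A kernel: bounded, symmetric, measurable. -/
def IsKernel (W : ℝ → ℝ → ℝ) : Prop :=
  Measurable (Function.uncurry W) ∧ IsSymm2 W ∧ ∃ C, ∀ x y, |W x y| ≤ C

/-- A graphon: symmetric measurable with values in `[0,1]`. -/
def IsGraphon (W : ℝ → ℝ → ℝ) : Prop :=
  Measurable (Function.uncurry W) ∧ IsSymm2 W ∧ ∀ x y, W x y ∈ Set.Icc (0:ℝ) 1

/-- The pair `(G₁, G₂)` is `(p₁,p₂)`-common. -/
def IsCommonPair {V₁ V₂ : Type*} [Fintype V₁] [Fintype V₂]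
    (G₁ : SimpleGraph V₁) (G₂ : SimpleGraph V₂) (p₁ p₂ : ℝ) : Prop :=
  ∀ W₁ W₂ : ℝ → ℝ → ℝ, IsGraphon W₁ → IsGraphon W₂ → (∀ x y, W₁ x y + W₂ x y = 1) →
    homDensity G₁ W₁ / (eCount G₁ * p₁ ^ (eCount G₁ - 1))
      + homDensity G₂ W₂ / (eCount G₂ * p₂ ^ (eCount G₂ - 1))
      ≥ p₁ / eCount G₁ + p₂ / eCount G₂

/-- The number of (unlabelled) cycles of length `k` in `G`, i.e. the number of
subgraphs of `G` isomorphic to `C_k`. -/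
noncomputable def cycleCount {V : Type*} (k : ℕ) (G : SimpleGraph V) : ℕ :=
  Nat.card {H' : G.Subgraph // Nonempty (H'.coe ≃g SimpleGraph.cycleGraph k)}

open Classical in
/-- The sets of `j` edges of `G` in which every vertex has even degree. -/
noncomputable def evenEdgeSets {V : Type*} [Fintype V] (G : SimpleGraph V) (j : ℕ) :
    Finset (Finset (Sym2 V)) :=
  (G.edgeFinset.powersetCard j).filter fun F => ∀ v, Even #(F.filter (v ∈ ·))

namespace SimpleGraph

open Classical in
theorem exists_isCycle_of_even_degree {V : Type*} [Fintype V] (G : SimpleGraph V)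
    {F : Finset (Sym2 V)} (hFG : (F : Set (Sym2 V)) ⊆ G.edgeSet) (hF : F.Nonempty)
    (heven : ∀ v, Even #(F.filter (v ∈ ·))) :
    ∃ (v : V) (w : (fromEdgeSet (F : Set (Sym2 V))).Walk v v), w.IsCycle := by
  by_contra! hac
  set T := fromEdgeSet (F : Set (Sym2 V)) with hT
  have hacyc : T.IsAcyclic := fun v w hw => hac v w hw
  have hadj : ∀ u v, T.Adj u v ↔ s(u, v) ∈ F := by
    intro u v
    simp only [hT, fromEdgeSet_adj, Finset.mem_coe, and_iff_left_iff_imp]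
    intro h
    exact (G.mem_edgeSet.mp (hFG h)).ne
  obtain ⟨e, he⟩ := hF
  induction e with | h a b =>
  have : Nonempty V := ⟨a⟩
  obtain ⟨u, v, p, hp, hmax⟩ := Walk.exists_isPath_forall_isPath_length_le_length T
  have hab : T.Adj a b := (hadj a b).mpr he
  have hlen : 1 ≤ p.length := by
    simpa using hmax _ _ hab.toWalk (Walk.IsPath.of_adj hab)
  have hnil : ¬p.Nil := by
    rw [Walk.not_nil_iff_lt_length]; exact hlen
  have hsnd : s(u, p.snd) ∈ F.filter (u ∈ ·) := by
    rw [Finset.mem_filter]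
    exact ⟨(hadj _ _).mp (p.adj_snd hnil), by simp⟩
  have htwo : 1 < #(F.filter (u ∈ ·)) := by
    have h0 := Finset.card_pos.mpr ⟨_, hsnd⟩
    obtain ⟨r, hr⟩ := heven u
    omega
  obtain ⟨e', he', hne⟩ := Finset.exists_mem_ne htwo s(u, p.snd)
  rw [Finset.mem_filter] at he'
  obtain ⟨he'F, w, rfl⟩ := he'
  have huw : T.Adj u w := (hadj _ _).mpr he'F
  have hw : w ∈ p.support := by
    by_contra hw
    have := hmax _ _ (p.cons huw.symm) (hp.cons hw)
    simp at this
  exact hne (by rw [hacyc.eq_snd_of_adj_start hp huw hw])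

open Classical in
theorem mem_evenEdgeSets_edges {V : Type*} [Fintype V] {G : SimpleGraph V} {v : V}
    {w : G.Walk v v} (hw : w.IsTrail) : w.edges.toFinset ∈ evenEdgeSets G w.length := by
  simp only [evenEdgeSets, Finset.mem_filter, Finset.mem_powersetCard]
  refine ⟨⟨fun e he => ?_, ?_⟩, fun x => ?_⟩
  · rw [mem_edgeFinset]
    exact w.edges_subset_edgeSet (by simpa using he)
  · rw [List.toFinset_card_of_nodup hw.edges_nodup, Walk.length_edges]
  · have h := (hw.even_countP_edges_iff x).mpr (by simp)
    rw [List.countP_eq_length_filter] at h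
    rw [← List.toFinset_card_of_nodup (hw.edges_nodup.filter _)] at h
    convert h using 2
    ext e
    simp

open Classical in
theorem egirth_le_of_mem_evenEdgeSets {V : Type*} [Fintype V] {G : SimpleGraph V} {j : ℕ}
    (hj : j ≠ 0) {F : Finset (Sym2 V)} (hF : F ∈ evenEdgeSets G j) : G.egirth ≤ j := by
  simp only [evenEdgeSets, Finset.mem_filter, Finset.mem_powersetCard] at hF
  obtain ⟨⟨hFG, rfl⟩, heven⟩ := hF
  have hFG' : (F : Set (Sym2 V)) ⊆ G.edgeSet := fun e he => mem_edgeFinset.mp (hFG he)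
  obtain ⟨v, w, hw⟩ := G.exists_isCycle_of_even_degree hFG' (Finset.card_ne_zero.mp hj) heven
  have hle : fromEdgeSet (F : Set (Sym2 V)) ≤ G := by
    rw [← G.fromEdgeSet_edgeSet]
    exact fromEdgeSet_mono hFG'
  refine (egirth_anti hle).trans ((egirth_le_length hw).trans ?_)
  rw [Nat.cast_le, ← w.length_edges, ← List.toFinset_card_of_nodup hw.edges_nodup]
  refine Finset.card_le_card fun e he => ?_
  have := w.edges_subset_edgeSet (by simpa using he : e ∈ w.edges)
  rw [edgeSet_fromEdgeSet] at this
  exact this.1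

theorem card_evenEdgeSets_zero {V : Type*} [Fintype V] (G : SimpleGraph V) :
    #(evenEdgeSets G 0) = 1 := by
  simp [evenEdgeSets, Finset.filter_singleton]

theorem card_evenEdgeSets_eq_zero {V : Type*} [Fintype V] {G : SimpleGraph V} {j : ℕ}
    (hj : j ≠ 0) (hjg : (j : ℕ∞) < G.egirth) : #(evenEdgeSets G j) = 0 := by
  rw [Finset.card_eq_zero, Finset.eq_empty_iff_forall_notMem]
  exact fun F hF => (egirth_le_of_mem_evenEdgeSets hj hF).not_gt hjg

theorem card_evenEdgeSets_pos {V : Type*} [Fintype V] {G : SimpleGraph V} {k : ℕ}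
    (hg : G.egirth = k) : 0 < #(evenEdgeSets G k) := by
  classical
  have hac : ¬G.IsAcyclic := by
    rw [← egirth_eq_top, hg]; simp
  obtain ⟨v, w, hw, hlen⟩ := exists_egirth_eq_length.mpr hac
  rw [hg, Nat.cast_inj] at hlen
  exact Finset.card_pos.mpr ⟨_, hlen ▸ mem_evenEdgeSets_edges hw.isTrail⟩

theorem card_edgeFinset_cycleGraph (n : ℕ) : #(cycleGraph (n + 3)).edgeFinset = n + 3 := by
  have h := (cycleGraph (n + 3)).sum_degrees_eq_twice_card_edges
  simp only [cycleGraph_degree_three_le, Finset.sum_const, Finset.card_univ, Fintype.card_fin,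
    smul_eq_mul] at h
  omega

theorem Subgraph.ncard_edgeSet_of_iso {V W : Type*} {G : SimpleGraph V} {K : SimpleGraph W}
    {H : G.Subgraph} (f : H.coe ≃g K) : H.edgeSet.ncard = K.edgeSet.ncard := by
  rw [← H.image_coe_edgeSet_coe,
    Set.ncard_image_of_injective _ (Sym2.map.injective Subtype.val_injective)]
  exact Nat.card_congr f.mapEdgeSet

theorem ncard_edgeSet_cycleGraph (n : ℕ) : (cycleGraph (n + 3)).edgeSet.ncard = n + 3 := by
  rw [← coe_edgeFinset, Set.ncard_coe_finset, card_edgeFinset_cycleGraph]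

theorem Subgraph.edgeSet_toFinset_mem_evenEdgeSets {V : Type*} [Fintype V] {G : SimpleGraph V}
    {n : ℕ} {H : G.Subgraph} (f : H.coe ≃g cycleGraph (n + 3)) :
    (Set.toFinite H.edgeSet).toFinset ∈ evenEdgeSets G (n + 3) := by
  classical
  set φ : cycleGraph (n + 3) →g G := H.hom.comp f.symm.toHom with hφ
  have hinj : Function.Injective φ := Subtype.val_injective.comp f.symm.injective
  set w := (cycleGraph.cycle n).map φ with hw
  have hcyc : w.IsCycle :=
    (Walk.isCycle_map_iff_of_injective hinj).mpr cycleGraph.isCycle_cycle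
  have hlen : w.length = n + 3 := by
    rw [hw, Walk.length_map, cycleGraph.length_cycle]
  have hmem := mem_evenEdgeSets_edges hcyc.isTrail
  rw [hlen] at hmem
  convert hmem
  symm
  apply Finset.eq_of_subset_of_card_le
  · intro e he
    simp only [hw, Walk.edges_map, List.mem_toFinset, List.mem_map] at he
    obtain ⟨e', he', rfl⟩ := he
    have h := Walk.edges_subset_edgeSet _ he'
    induction e' with | h a b =>
    rw [Set.Finite.mem_toFinset]
    exact f.symm.map_adj_iff.mpr h
  · rw [← Set.ncard_eq_toFinset_card, H.ncard_edgeSet_of_iso f, ncard_edgeSet_cycleGraph,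
      List.toFinset_card_of_nodup hcyc.edges_nodup, Walk.length_edges, hlen]

theorem Subgraph.mem_verts_iff_of_iso_cycleGraph {V : Type*} {G : SimpleGraph V}
    {n : ℕ} {H : G.Subgraph} (f : H.coe ≃g cycleGraph (n + 3)) (v : V) :
    v ∈ H.verts ↔ ∃ w, H.Adj v w := by
  refine ⟨fun hv => ?_, fun ⟨w, hw⟩ => hw.fst_mem⟩
  have h : (cycleGraph (n + 3)).Adj (f ⟨v, hv⟩) (f ⟨v, hv⟩ + 1) := by
    rw [cycleGraph_adj]; right; simp
  refine ⟨f.symm (f ⟨v, hv⟩ + 1), ?_⟩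
  have := f.symm.map_adj_iff.mpr h
  simpa using this

theorem exists_subgraph_of_mem_evenEdgeSets {V : Type*} [Fintype V] {G : SimpleGraph V}
    {n : ℕ} (hg : (n + 3 : ℕ) ≤ G.egirth) {F : Finset (Sym2 V)}
    (hF : F ∈ evenEdgeSets G (n + 3)) :
    ∃ H : G.Subgraph, Nonempty (H.coe ≃g cycleGraph (n + 3)) ∧ H.edgeSet = F := by
  classical
  simp only [evenEdgeSets, Finset.mem_filter, Finset.mem_powersetCard] at hF
  obtain ⟨⟨hFG, hcard⟩, heven⟩ := hF
  have hFG' : (F : Set (Sym2 V)) ⊆ G.edgeSet := fun e he => mem_edgeFinset.mp (hFG he)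
  set T := fromEdgeSet (F : Set (Sym2 V)) with hT
  obtain ⟨v, w, hw⟩ : ∃ (v : V) (w : T.Walk v v), w.IsCycle :=
    G.exists_isCycle_of_even_degree hFG' (Finset.card_ne_zero.mp (by omega)) heven
  have hTF : T.edgeSet ⊆ F := by
    rw [hT, edgeSet_fromEdgeSet]; exact Set.sdiff_subset
  have hle : T ≤ G := by
    rw [← G.fromEdgeSet_edgeSet]
    exact fromEdgeSet_mono hFG'
  have hupper : w.length ≤ n + 3 := by
    rw [← hcard, ← w.length_edges, ← List.toFinset_card_of_nodup hw.edges_nodup]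
    exact Finset.card_le_card fun e he =>
      hTF (w.edges_subset_edgeSet (by simpa using he : e ∈ w.edges))
  have hlower : n + 3 ≤ w.length :=
    Nat.cast_le.mp (hg.trans ((egirth_anti hle).trans (egirth_le_length hw)))
  obtain ⟨c⟩ := (cycleGraph_isContained_iff (G := T) (n := n + 3) (by omega)).mpr
    ⟨v, w, hw, by omega⟩
  set d : Copy (cycleGraph (n + 3)) G := (Copy.ofLE T G hle).comp c
  refine ⟨d.toSubgraph, ⟨d.isoToSubgraph.symm⟩, ?_⟩
  refine Set.eq_of_subset_of_ncard_le ?_ ?_ F.finite_toSet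
  · intro e he
    induction e with | h a b =>
    rw [Subgraph.mem_edgeSet] at he
    obtain ⟨x, y, hxy, rfl, rfl⟩ := he
    exact hTF (c.toHom.map_adj hxy)
  · rw [Set.ncard_coe_finset, hcard, Subgraph.ncard_edgeSet_of_iso d.isoToSubgraph.symm,
      ncard_edgeSet_cycleGraph]

end SimpleGraph

theorem card_evenEdgeSets_eq_cycleCount {V : Type*} [Fintype V] {G : SimpleGraph V} {k : ℕ}
    (hg : G.egirth = k) : #(evenEdgeSets G k) = cycleCount k G := by
  classical
  obtain ⟨n, rfl⟩ : ∃ n, k = n + 3 := by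
    have h := G.three_le_egirth
    rw [hg] at h
    have h3 : 3 ≤ k := by exact_mod_cast h
    exact ⟨k - 3, by omega⟩
  rw [cycleCount, ← Nat.card_eq_finsetCard]
  symm
  refine Nat.card_eq_of_bijective
    (fun H => ⟨(Set.toFinite H.1.edgeSet).toFinset,
      H.1.edgeSet_toFinset_mem_evenEdgeSets H.2.some⟩ :
      {H : G.Subgraph // Nonempty (H.coe ≃g SimpleGraph.cycleGraph (n + 3))} →
        {F // F ∈ evenEdgeSets G (n + 3)}) ⟨?_, ?_⟩
  · rintro ⟨H, ⟨f⟩⟩ ⟨H', ⟨f'⟩⟩ h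
    simp only [Subtype.mk.injEq, Set.Finite.toFinset_inj] at h
    have hadj : H.Adj = H'.Adj := by
      ext a b
      rw [← SimpleGraph.Subgraph.mem_edgeSet, h, SimpleGraph.Subgraph.mem_edgeSet]
    refine Subtype.ext (SimpleGraph.Subgraph.ext ?_ hadj)
    ext v
    rw [H.mem_verts_iff_of_iso_cycleGraph f, H'.mem_verts_iff_of_iso_cycleGraph f', hadj]
  · rintro ⟨F, hF⟩
    obtain ⟨H, hH, hHF⟩ := SimpleGraph.exists_subgraph_of_mem_evenEdgeSets hg.ge hF
    exact ⟨⟨H, hH⟩, Subtype.ext (Finset.coe_injective (by simpa using hHF))⟩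

/-- The function equal to `1` on the left half of the unit interval and `-1` on the right half. -/
noncomputable def halfSign (t : ℝ) : ℝ := if t < 1 / 2 then 1 else -1

theorem measurable_halfSign : Measurable halfSign :=
  Measurable.ite measurableSet_Iio measurable_const measurable_const

theorem halfSign_eq_or (t : ℝ) : halfSign t = 1 ∨ halfSign t = -1 := by
  unfold halfSign; split_ifs <;> simp

instance : IsProbabilityMeasure unitM := ⟨by simp [unitM]⟩

theorem integrable_halfSign_pow (n : ℕ) : Integrable (fun t => halfSign t ^ n) unitM := by
  refine Integrable.of_bound (measurable_halfSign.pow_const n).aestronglyMeasurable 1 ?_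
  refine Filter.Eventually.of_forall fun t => ?_
  rcases halfSign_eq_or t with h | h <;> simp [h]

theorem integral_halfSign : ∫ t, halfSign t ∂unitM = 0 := by
  have h : halfSign = fun t => (Set.Iio (1 / 2 : ℝ)).indicator (fun _ => (2 : ℝ)) t - 1 := by
    ext t
    by_cases ht : t < 1 / 2
    · rw [halfSign, if_pos ht, Set.indicator_of_mem (Set.mem_Iio.mpr ht)]; norm_num
    · rw [halfSign, if_neg ht, Set.indicator_of_notMem (by simpa using ht)]; norm_num
  have hset : Set.Iio (1 / 2 : ℝ) ∩ Set.Icc 0 1 = Set.Ico 0 (1 / 2) := by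
    ext t
    simp only [Set.mem_inter_iff, Set.mem_Iio, Set.mem_Icc, Set.mem_Ico]
    constructor
    · rintro ⟨h1, h2, -⟩; exact ⟨h2, h1⟩
    · rintro ⟨h1, h2⟩; exact ⟨h2, h1, by linarith⟩
  have hmeas : unitM.real (Set.Iio (1 / 2)) = 1 / 2 := by
    rw [unitM, measureReal_restrict_apply measurableSet_Iio, hset]
    simp
  rw [h, integral_sub ((integrable_const _).indicator measurableSet_Iio) (integrable_const _),
    integral_indicator_const _ measurableSet_Iio, hmeas]
  simp

theorem integral_halfSign_pow (n : ℕ) :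
    ∫ t, halfSign t ^ n ∂unitM = if Even n then 1 else 0 := by
  have hsq : ∀ t, halfSign t ^ 2 = 1 := fun t => by
    rcases halfSign_eq_or t with h | h <;> simp [h]
  split_ifs with hn
  · obtain ⟨m, rfl⟩ := hn
    simp_rw [← two_mul, pow_mul, hsq]
    simp
  · obtain ⟨m, rfl⟩ := Nat.not_even_iff_odd.mp hn
    simp_rw [pow_succ, pow_mul, hsq]
    simpa using integral_halfSign

/-- The constant `a` perturbed by `b` times the rank one kernel of `halfSign`. -/
noncomputable def signKernel (a b : ℝ) : ℝ → ℝ → ℝ :=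
  fun x y => a + b * (halfSign x * halfSign y)

theorem isGraphon_signKernel {a b : ℝ} (h₀ : |b| ≤ a) (h₁ : |b| ≤ 1 - a) :
    IsGraphon (signKernel a b) := by
  refine ⟨?_, fun x y => by unfold signKernel; ring, fun x y => ?_⟩
  · have hf : Measurable fun z : ℝ × ℝ => halfSign z.1 := measurable_halfSign.comp measurable_fst
    have hg : Measurable fun z : ℝ × ℝ => halfSign z.2 := measurable_halfSign.comp measurable_snd
    exact ((hf.mul hg).const_mul b).const_add a
  · have h2 := neg_abs_le b
    have h3 := le_abs_self b
    unfold signKernel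
    rcases halfSign_eq_or x with hx | hx <;> rcases halfSign_eq_or y with hy | hy <;>
      rw [hx, hy, Set.mem_Icc] <;> constructor <;> linarith

open Classical in
theorem prod_symEdge_signKernel {V : Type*} [Fintype V] (G : SimpleGraph V) (a b : ℝ)
    (x : V → ℝ) :
    ∏ e ∈ G.edgeFinset, symEdge (signKernel a b) x e =
      ∑ F ∈ G.edgeFinset.powerset, a ^ (#G.edgeFinset - #F) * b ^ #F *
        ∏ v, halfSign (x v) ^ #(F.filter (v ∈ ·)) := by
  have hedge : ∀ e ∈ G.edgeFinset, symEdge (signKernel a b) x e =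
      b * (∏ v, if v ∈ e then halfSign (x v) else 1) + a := by
    intro e he
    induction e with | h u v =>
    have huv : u ≠ v := by
      rw [SimpleGraph.mem_edgeFinset] at he
      exact (G.mem_edgeSet.mp he).ne
    have hprod : (∏ w, if w ∈ s(u, v) then halfSign (x w) else 1) =
        halfSign (x u) * halfSign (x v) := by
      rw [← Finset.prod_filter, ← Finset.prod_pair (f := fun w => halfSign (x w)) huv]
      congr 1
      ext w
      simp
    rw [hprod]
    simp only [symEdge, Sym2.lift_mk, signKernel]
    ring
  rw [Finset.prod_congr rfl hedge, Finset.prod_add]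
  refine Finset.sum_congr rfl fun F hF => ?_
  rw [Finset.mem_powerset] at hF
  rw [Finset.prod_mul_distrib, Finset.prod_const, Finset.prod_const, Finset.prod_comm,
    Finset.card_sdiff_of_subset hF]
  have hpow : ∀ v, (∏ e ∈ F, if v ∈ e then halfSign (x v) else 1) =
      halfSign (x v) ^ #(F.filter (v ∈ ·)) := fun v => by
    rw [← Finset.prod_filter, Finset.prod_const]
  simp_rw [hpow]
  ring

theorem integral_prod_halfSign_pow {V : Type*} [Fintype V] (d : V → ℕ) :
    ∫ x : V → ℝ, ∏ v, halfSign (x v) ^ d v ∂(Measure.pi fun _ => unitM) =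
      if ∀ v, Even (d v) then 1 else 0 := by
  classical
  rw [integral_fintype_prod_eq_prod (μ := fun _ => unitM) (fun v t => halfSign t ^ d v)]
  simp_rw [integral_halfSign_pow]
  rw [Finset.prod_ite_zero]
  simp

open Classical in
theorem homDensity_signKernel {V : Type*} [Fintype V] (G : SimpleGraph V) (a b : ℝ) :
    homDensity G (signKernel a b) =
      ∑ j ∈ range (eCount G + 1), #(evenEdgeSets G j) * a ^ (eCount G - j) * b ^ j := by
  have hcard : eCount G = #G.edgeFinset := by
    rw [eCount, ← SimpleGraph.coe_edgeFinset, Set.ncard_coe_finset]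
  have hintegrable : ∀ F ∈ G.edgeFinset.powerset, Integrable (fun x : V → ℝ =>
      a ^ (#G.edgeFinset - #F) * b ^ #F * ∏ v, halfSign (x v) ^ #(F.filter (v ∈ ·)))
      (Measure.pi fun _ => unitM) := fun F _ =>
    (Integrable.fintype_prod (f := fun v t => halfSign t ^ #(F.filter (v ∈ ·)))
      fun v => integrable_halfSign_pow _).const_mul _
  have hhom : homDensity G (signKernel a b) =
      ∫ x : V → ℝ, ∏ e ∈ G.edgeFinset, symEdge (signKernel a b) x e
        ∂(Measure.pi fun _ => unitM) := by
    unfold homDensity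
    congr!
  rw [hhom]
  simp_rw [prod_symEdge_signKernel]
  rw [integral_finsetSum _ hintegrable]
  simp_rw [integral_const_mul, integral_prod_halfSign_pow]
  rw [Finset.sum_powerset, hcard]
  refine Finset.sum_congr rfl fun j _ => ?_
  have hterm : ∀ F ∈ G.edgeFinset.powersetCard j,
      (a ^ (#G.edgeFinset - #F) * b ^ #F * if ∀ v, Even #(F.filter (v ∈ ·)) then (1 : ℝ) else 0) =
        if ∀ v, Even #(F.filter (v ∈ ·)) then a ^ (#G.edgeFinset - j) * b ^ j else 0 := by
    intro F hF
    rw [(Finset.mem_powersetCard.mp hF).2, mul_ite, mul_one, mul_zero]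
  rw [Finset.sum_congr rfl hterm, ← Finset.sum_filter, Finset.sum_const, nsmul_eq_mul,
    mul_assoc]
  rfl

/-- If a real polynomial is nonnegative near `0`, then its lowest coefficient cannot have odd
index. -/
theorem Polynomial.coeff_eq_zero_of_odd_of_nonneg {Q : Polynomial ℝ} {k : ℕ} (hk : Odd k)
    {δ : ℝ} (hδ : 0 < δ) (hQ : ∀ ε, |ε| ≤ δ → 0 ≤ Q.eval ε) (hlow : ∀ j < k, Q.coeff j = 0) :
    Q.coeff k = 0 := by
  obtain ⟨R, rfl⟩ := Polynomial.X_pow_dvd_iff.mpr hlow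
  rw [Polynomial.coeff_X_pow_mul', if_pos le_rfl, Nat.sub_self, Polynomial.coeff_zero_eq_eval_zero]
  have hR : Filter.Tendsto (fun ε => R.eval ε) (nhds 0) (nhds (R.eval 0)) :=
    R.continuous.tendsto 0
  apply le_antisymm
  · refine le_of_tendsto (hR.mono_left (nhdsWithin_le_nhds (s := Set.Iio 0))) ?_
    filter_upwards [Ioo_mem_nhdsLT (neg_lt_zero.mpr hδ)] with ε hε
    have h := hQ ε (abs_le.mpr ⟨hε.1.le, by linarith [hε.2]⟩)
    rw [Polynomial.eval_mul, Polynomial.eval_pow, Polynomial.eval_X] at h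
    exact nonpos_of_mul_nonneg_right h (hk.pow_neg hε.2)
  · refine ge_of_tendsto (hR.mono_left (nhdsWithin_le_nhds (s := Set.Ioi 0))) ?_
    filter_upwards [Ioo_mem_nhdsGT hδ] with ε hε
    have h := hQ ε (abs_le.mpr ⟨by linarith [hε.1], hε.2.le⟩)
    rw [Polynomial.eval_mul, Polynomial.eval_pow, Polynomial.eval_X] at h
    exact nonneg_of_mul_nonneg_right h (pow_pos hε.1 k)

/-- The polynomial in `ε` giving the density of `G` in `signKernel a (s * ε)`. -/
noncomputable def densityPoly {V : Type*} [Fintype V] (G : SimpleGraph V) (a s : ℝ) :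
    Polynomial ℝ :=
  ∑ j ∈ range (eCount G + 1),
    Polynomial.C (#(evenEdgeSets G j) * a ^ (eCount G - j) * s ^ j) * Polynomial.X ^ j

theorem eval_densityPoly {V : Type*} [Fintype V] (G : SimpleGraph V) (a s ε : ℝ) :
    (densityPoly G a s).eval ε = homDensity G (signKernel a (s * ε)) := by
  rw [homDensity_signKernel, densityPoly, Polynomial.eval_finsetSum]
  refine Finset.sum_congr rfl fun j _ => ?_
  rw [Polynomial.eval_mul, Polynomial.eval_C, Polynomial.eval_pow, Polynomial.eval_X, mul_pow]
  ring

theorem le_eCount_of_card_evenEdgeSets_ne_zero {V : Type*} [Fintype V] {G : SimpleGraph V}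
    {j : ℕ} (h : #(evenEdgeSets G j) ≠ 0) : j ≤ eCount G := by
  classical
  obtain ⟨F, hF⟩ := Finset.card_ne_zero.mp h
  simp only [evenEdgeSets, Finset.mem_filter, Finset.mem_powersetCard] at hF
  rw [eCount, ← SimpleGraph.coe_edgeFinset, Set.ncard_coe_finset, ← hF.1.2]
  exact Finset.card_le_card hF.1.1

theorem coeff_densityPoly {V : Type*} [Fintype V] (G : SimpleGraph V) (a s : ℝ) (j : ℕ) :
    (densityPoly G a s).coeff j = #(evenEdgeSets G j) * a ^ (eCount G - j) * s ^ j := by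
  simp only [densityPoly, Polynomial.finsetSum_coeff, Polynomial.coeff_C_mul_X_pow]
  rw [Finset.sum_ite_eq, ite_eq_left_iff]
  intro hj
  have h0 : #(evenEdgeSets G j) = 0 := by
    by_contra h
    exact hj (Finset.mem_range.mpr (Nat.lt_succ_of_le (le_eCount_of_card_evenEdgeSets_ne_zero h)))
  simp [h0]

theorem IsCommonPair.card_evenEdgeSets_eq {V₁ V₂ : Type*} [Fintype V₁] [Fintype V₂]
    {G₁ : SimpleGraph V₁} {G₂ : SimpleGraph V₂} {p : ℝ} (hp : p ∈ Set.Ioo (0 : ℝ) 1)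
    (hcommon : IsCommonPair G₁ G₂ p (1 - p)) (he₁ : eCount G₁ ≠ 0) (he₂ : eCount G₂ ≠ 0)
    {k : ℕ} (hk : Odd k) (hk₁ : (k : ℕ∞) ≤ G₁.egirth) (hk₂ : (k : ℕ∞) ≤ G₂.egirth) :
    #(evenEdgeSets G₁ k) * p ^ (eCount G₁ - k) / (eCount G₁ * p ^ (eCount G₁ - 1)) =
      #(evenEdgeSets G₂ k) * (1 - p) ^ (eCount G₂ - k) /
        (eCount G₂ * (1 - p) ^ (eCount G₂ - 1)) := by
  obtain ⟨hp0, hp1⟩ := hp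
  have hq0 : 0 < 1 - p := sub_pos.mpr hp1
  set Q : Polynomial ℝ :=
    Polynomial.C ((eCount G₁ * p ^ (eCount G₁ - 1) : ℝ)⁻¹) * densityPoly G₁ p 1 +
      Polynomial.C ((eCount G₂ * (1 - p) ^ (eCount G₂ - 1) : ℝ)⁻¹) * densityPoly G₂ (1 - p) (-1) -
      Polynomial.C (p / eCount G₁ + (1 - p) / eCount G₂) with hQdef
  have hQ : ∀ ε, |ε| ≤ min p (1 - p) → 0 ≤ Q.eval ε := by
    intro ε hε
    obtain ⟨hεp, hεq⟩ := le_min_iff.mp hε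
    have h := hcommon (signKernel p (1 * ε)) (signKernel (1 - p) (-1 * ε))
      (isGraphon_signKernel (by simpa using hεp) (by simpa using hεq))
      (isGraphon_signKernel (by simpa using hεq) (by simpa using hεp))
      (fun x y => by unfold signKernel; ring)
    simp only [hQdef, Polynomial.eval_sub, Polynomial.eval_add, Polynomial.eval_mul,
      Polynomial.eval_C, eval_densityPoly]
    rw [div_eq_inv_mul, div_eq_inv_mul (homDensity G₂ _)] at h
    linarith
  have hcoeff : ∀ j ≠ 0, Q.coeff j =
      (eCount G₁ * p ^ (eCount G₁ - 1) : ℝ)⁻¹ *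
          (#(evenEdgeSets G₁ j) * p ^ (eCount G₁ - j) * 1 ^ j) +
        (eCount G₂ * (1 - p) ^ (eCount G₂ - 1) : ℝ)⁻¹ *
          (#(evenEdgeSets G₂ j) * (1 - p) ^ (eCount G₂ - j) * (-1) ^ j) := fun j hj => by
    simp only [hQdef, Polynomial.coeff_sub, Polynomial.coeff_add, Polynomial.coeff_C_mul,
      coeff_densityPoly, Polynomial.coeff_C_of_ne_zero hj, sub_zero]
  have hnormalize : ∀ (e : ℕ) (a : ℝ), e ≠ 0 → 0 < a →
      (e * a ^ (e - 1) : ℝ)⁻¹ * a ^ e = a / e := by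
    intro e a he ha
    obtain ⟨n, rfl⟩ := Nat.exists_eq_succ_of_ne_zero he
    have : ((n.succ : ℕ) : ℝ) ≠ 0 := by exact_mod_cast he
    rw [Nat.succ_sub_one, pow_succ]
    field_simp
  have hlow : ∀ j < k, Q.coeff j = 0 := by
    intro j hj
    rcases eq_or_ne j 0 with rfl | hj0
    · simp only [hQdef, Polynomial.coeff_sub, Polynomial.coeff_add, Polynomial.coeff_C_mul,
        coeff_densityPoly, Polynomial.coeff_C_zero, SimpleGraph.card_evenEdgeSets_zero,
        Nat.cast_one, one_mul, pow_zero, mul_one, Nat.sub_zero]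
      rw [hnormalize _ _ he₁ hp0, hnormalize _ _ he₂ hq0, sub_self]
    · have hjk : (j : ℕ∞) < k := Nat.cast_lt.mpr hj
      rw [hcoeff j hj0, SimpleGraph.card_evenEdgeSets_eq_zero hj0 (hjk.trans_le hk₁),
        SimpleGraph.card_evenEdgeSets_eq_zero hj0 (hjk.trans_le hk₂)]
      simp
  have hmain := Polynomial.coeff_eq_zero_of_odd_of_nonneg hk (lt_min hp0 hq0) hQ hlow
  rw [hcoeff k hk.pos.ne', hk.neg_one_pow] at hmain
  rw [div_eq_inv_mul, div_eq_inv_mul]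
  linear_combination hmain

/-- If `H₁` and `H₂` have odd girth, `k = g(H₁)`, and `(H₁,H₂)` is `(p,1-p)`-common,
then `g(H₂) = k` and `p = 1/(α+1)` where
`α = (c_k(H₂)e(H₁)/(c_k(H₁)e(H₂)))^{1/(k-1)}`. -/
theorem oddGirth_common_p {V₁ V₂ : Type*} [Fintype V₁] [Fintype V₂]
    (G₁ : SimpleGraph V₁) (G₂ : SimpleGraph V₂)
    (k₁ k₂ : ℕ) (hodd₁ : Odd k₁) (hodd₂ : Odd k₂)
    (hg₁ : G₁.egirth = (k₁ : ℕ∞)) (hg₂ : G₂.egirth = (k₂ : ℕ∞))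
    (p : ℝ) (hp : p ∈ Set.Ioo (0:ℝ) 1)
    (hcommon : IsCommonPair G₁ G₂ p (1 - p)) :
    G₂.egirth = (k₁ : ℕ∞) ∧
      p = 1 / (((cycleCount k₁ G₂ * eCount G₁ : ℝ) /
        (cycleCount k₁ G₁ * eCount G₂)) ^ ((1 : ℝ) / ((k₁ : ℝ) - 1)) + 1) := by
  
  have hpos₁ := SimpleGraph.card_evenEdgeSets_pos hg₁
  have hpos₂ := SimpleGraph.card_evenEdgeSets_pos hg₂
  have hle₁ := le_eCount_of_card_evenEdgeSets_ne_zero hpos₁.ne'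
  have hle₂ := le_eCount_of_card_evenEdgeSets_ne_zero hpos₂.ne'
  have he₁ : 0 < eCount G₁ := hodd₁.pos.trans_le hle₁
  have he₂ : 0 < eCount G₂ := hodd₂.pos.trans_le hle₂
  have hp0 : 0 < p := hp.1
  have hq0 : 0 < 1 - p := sub_pos.mpr hp.2
  have hposterm : ∀ (n e k : ℕ) (a : ℝ), 0 < n → 0 < e → 0 < a →
      0 < n * a ^ (e - k) / (e * a ^ (e - 1)) := fun n e k a hn he ha => by positivity
  obtain rfl : k₁ = k₂ := by
    rcases lt_trichotomy k₁ k₂ with h | h | h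
    · have hlt : (k₁ : ℕ∞) < G₂.egirth := by rw [hg₂]; exact_mod_cast h
      have heq := hcommon.card_evenEdgeSets_eq hp he₁.ne' he₂.ne' hodd₁ hg₁.ge hlt.le
      rw [SimpleGraph.card_evenEdgeSets_eq_zero hodd₁.pos.ne' hlt] at heq
      have := hposterm _ _ k₁ p hpos₁ he₁ hp0
      rw [heq] at this
      simp at this
    · exact h
    · have hlt : (k₂ : ℕ∞) < G₁.egirth := by rw [hg₁]; exact_mod_cast h
      have heq := hcommon.card_evenEdgeSets_eq hp he₁.ne' he₂.ne' hodd₂ hlt.le hg₂.ge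
      rw [SimpleGraph.card_evenEdgeSets_eq_zero hodd₂.pos.ne' hlt] at heq
      have := hposterm _ _ k₂ (1 - p) hpos₂ he₂ hq0
      rw [← heq] at this
      simp at this
  refine ⟨hg₂, ?_⟩
  have heq := hcommon.card_evenEdgeSets_eq hp he₁.ne' he₂.ne' hodd₁ hg₁.ge hg₂.ge
  rw [card_evenEdgeSets_eq_cycleCount hg₁] at heq hpos₁
  rw [card_evenEdgeSets_eq_cycleCount hg₂] at heq hpos₂
  have hk3 : 3 ≤ k₁ := by
    have h := G₁.three_le_egirth
    rw [hg₁] at h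
    exact_mod_cast h
  have hcancel : ∀ (c e : ℕ) (a : ℝ), k₁ ≤ e → 0 < a →
      c * a ^ (e - k₁) / (e * a ^ (e - 1)) = c / (e * a ^ (k₁ - 1)) := by
    intro c e a hke ha
    have he : (e : ℝ) ≠ 0 := by exact_mod_cast (by omega : e ≠ 0)
    rw [show e - 1 = (e - k₁) + (k₁ - 1) by omega, pow_add]
    field_simp
  rw [hcancel _ _ _ hle₁ hp0, hcancel _ _ _ hle₂ hq0] at heq
  have hE₁ : (0 : ℝ) < eCount G₁ := Nat.cast_pos.mpr he₁
  have hE₂ : (0 : ℝ) < eCount G₂ := Nat.cast_pos.mpr he₂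
  have hC₁ : (0 : ℝ) < cycleCount k₁ G₁ := Nat.cast_pos.mpr hpos₁
  have hratio : (cycleCount k₁ G₂ * eCount G₁ : ℝ) / (cycleCount k₁ G₁ * eCount G₂) =
      ((1 - p) / p) ^ (k₁ - 1) := by
    rw [div_eq_div_iff (by positivity) (by positivity)] at heq
    rw [div_pow, div_eq_div_iff (by positivity) (by positivity)]
    linear_combination -heq
  have hexp : (1 : ℝ) / ((k₁ : ℝ) - 1) = (((k₁ - 1 : ℕ) : ℝ))⁻¹ := by
    rw [Nat.cast_sub (by omega), Nat.cast_one, one_div]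
  rw [hratio, hexp, Real.pow_rpow_inv_natCast (by positivity) (by omega)]
  field_simp
  ring
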